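/- arXiv:2309.04728 — 2 statements merged into one kernel-verified Lean document; each statement's English description precedes it below -/
import Mathlib

section
/- There exist an integer m_min ≥ 1 and a radius ε > 0 such that for every input sequence v : ℤ → U with minimum repetitions ≥ m_min the following holds: if A^1, …, A^E are E pairwise distinct entire attractor sequences for v, then there exist E pairwise distinct entire solutions x^1, …, x^E for input v such that for each e, x^e(k) ∈ B_{v(k+1)}^{A^e(k+1)} for all k ∈ ℤ and x^e pullback attracts the ε-neighbourhood of its attractor sequence, i.e. for every k ∈ ℤ, sup { |(f_{v(k−1)} ∘ ⋯ ∘ f_{v(k−n)})(y) − x^e(k)| : |y − x_{v(k−n)}^{A^e(k−n)}| ≤ ε } → 0 as n → ∞. (Hence the echo index of the driven system for such an input is at least E.) -/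
/-- The pullback composition `f_{v(k-1)} ∘ f_{v(k-2)} ∘ ⋯ ∘ f_{v(k-n)}` of the driven
system, over `n` steps ending at time `k`. -/
def pullComp {d M : ℕ}
    (f : Fin M → EuclideanSpace ℝ (Fin d) → EuclideanSpace ℝ (Fin d))
    (v : ℤ → Fin M) (k : ℤ) :
    ℕ → (EuclideanSpace ℝ (Fin d) → EuclideanSpace ℝ (Fin d))
  | 0 => id
  | (n + 1) => pullComp f v k n ∘ f (v (k - (n + 1)))

/-- The basin of attraction, within `X`, of the point `p` under the map `g`. -/
def basinOf {d : ℕ} (X : Set (EuclideanSpace ℝ (Fin d)))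
    (g : EuclideanSpace ℝ (Fin d) → EuclideanSpace ℝ (Fin d))
    (p : EuclideanSpace ℝ (Fin d)) : Set (EuclideanSpace ℝ (Fin d)) :=
  {y ∈ X | Filter.Tendsto (fun n : ℕ => g^[n] y) Filter.atTop (nhds p)}

/-- `v` has minimum repetitions `≥ m`: every maximal constant block of `v` has length at
least `m`. -/
def MinRepetitions {M : ℕ} (v : ℤ → Fin M) (m : ℕ) : Prop :=
  ∀ k : ℤ, v k ≠ v (k + 1) → ∀ j : ℕ, 1 ≤ j → j ≤ m → v (k + j) = v (k + 1)

section

open Filter Topology Metric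

/-- Near `q`, the iterates of `g` are Lipschitz with constants tending to `0`. -/
def ContractsAsymptoticallyNear {α : Type*} [PseudoMetricSpace α] (g : α → α) (q : α) : Prop :=
  ∃ δ : ℝ, 0 < δ ∧ ∃ b : ℕ → ℝ, (∀ n, 0 ≤ b n) ∧ Tendsto b atTop (𝓝 0) ∧
    ∀ y ∈ closedBall q δ, ∀ z ∈ closedBall q δ, ∀ n, dist (g^[n] y) (g^[n] z) ≤ b n * dist y z

theorem contDiff_iterate {𝕜 E : Type*} [NontriviallyNormedField 𝕜] [NormedAddCommGroup E]
    [NormedSpace 𝕜 E] {r : WithTop ℕ∞} {g : E → E} (hg : ContDiff 𝕜 r g) (n : ℕ) :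
    ContDiff 𝕜 r g^[n] := by
  induction n with
  | zero => exact contDiff_id
  | succ n ih => exact ih.comp hg

namespace ContractsAsymptoticallyNear

theorem eventually {α : Type*} [PseudoMetricSpace α] {g : α → α} {p : α}
    (h : ContractsAsymptoticallyNear g p) :
    ∀ᶠ q in 𝓝 p, ContractsAsymptoticallyNear g q := by
  obtain ⟨δ, hδ, b, hb0, hb, H⟩ := h
  filter_upwards [closedBall_mem_nhds p (half_pos hδ)] with q hq
  have hsub : closedBall q (δ / 2) ⊆ closedBall p δ :=
    closedBall_subset_closedBall' (by rw [mem_closedBall] at hq; linarith)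
  exact ⟨δ / 2, half_pos hδ, b, hb0, hb, fun y hy z hz n => H y (hsub hy) z (hsub hz) n⟩

theorem of_map {E : Type*} [NormedAddCommGroup E] [NormedSpace ℝ E] {g : E → E}
    (hg : ContDiff ℝ 1 g) {q : E} (h : ContractsAsymptoticallyNear g (g q)) :
    ContractsAsymptoticallyNear g q := by
  obtain ⟨δ, hδ, b, hb0, hb, H⟩ := h
  obtain ⟨K, t, ht, hK⟩ := hg.contDiffAt.exists_lipschitzOnWith (x := q)
  have hpre : g ⁻¹' closedBall (g q) δ ∈ 𝓝 q :=
    hg.continuous.continuousAt.preimage_mem_nhds (closedBall_mem_nhds _ hδ)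
  obtain ⟨δ', hδ', hsub⟩ := nhds_basis_closedBall.mem_iff.1 (inter_mem ht hpre)
  refine ⟨δ', hδ', fun n => n.casesOn 1 fun n => b n * K, ?_, ?_, ?_⟩
  · rintro (_ | n)
    · exact zero_le_one
    · exact mul_nonneg (hb0 n) K.2
  · rw [← tendsto_add_atTop_iff_nat 1]
    simpa using hb.mul_const (K : ℝ)
  · rintro y hy z hz (_ | n)
    · simp
    · calc dist (g^[n] (g y)) (g^[n] (g z)) ≤ b n * dist (g y) (g z) :=
            H _ (hsub hy).2 _ (hsub hz).2 n
        _ ≤ b n * (K * dist y z) :=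
            mul_le_mul_of_nonneg_left (hK.dist_le_mul _ (hsub hy).1 _ (hsub hz).1) (hb0 n)
        _ = b n * K * dist y z := by ring

theorem of_iterate {E : Type*} [NormedAddCommGroup E] [NormedSpace ℝ E] {g : E → E}
    (hg : ContDiff ℝ 1 g) (n : ℕ) {q : E} (h : ContractsAsymptoticallyNear g (g^[n] q)) :
    ContractsAsymptoticallyNear g q := by
  induction n generalizing q with
  | zero => exact h
  | succ n ih => exact of_map hg (ih h)

theorem of_tendsto {E : Type*} [NormedAddCommGroup E] [NormedSpace ℝ E] {g : E → E}
    (hg : ContDiff ℝ 1 g) {p q : E} (h : ContractsAsymptoticallyNear g p)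
    (hq : Tendsto (fun n : ℕ => g^[n] q) atTop (𝓝 p)) :
    ContractsAsymptoticallyNear g q :=
  let ⟨n, hn⟩ := (hq.eventually h.eventually).exists
  of_iterate hg n hn

theorem of_norm_fderiv_pow_lt_one {E : Type*} [NormedAddCommGroup E] [NormedSpace ℝ E]
    {g : E → E} (hg : ContDiff ℝ 1 g) {p : E} (hp : g p = p) {N : ℕ} (hN : 1 ≤ N)
    (hlt : ‖(fderiv ℝ g p) ^ N‖ < 1) : ContractsAsymptoticallyNear g p := by
  have hstrict : HasStrictFDerivAt g^[N] ((fderiv ℝ g p) ^ N) p :=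
    (hg.contDiffAt.hasStrictFDerivAt one_ne_zero).iterate hp N
  obtain ⟨a, ha, ha1⟩ := exists_between (show ‖(fderiv ℝ g p) ^ N‖₊ < 1 from hlt)
  obtain ⟨s, hs, hsa⟩ := hstrict.exists_lipschitzOnWith_of_nnnorm_lt a ha
  choose K t ht hK using fun n : ℕ => (contDiff_iterate hg n).contDiffAt.exists_lipschitzOnWith (x := p)
  obtain ⟨r, hr, hsub⟩ := nhds_basis_closedBall.mem_iff.1
    (inter_mem hs ((Filter.biInter_finset_mem (Finset.range N)).2 fun n _ => ht n))
  have ha1' : (a : ℝ) < 1 := ha1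
  have hfix : g^[N] p = p := Function.iterate_fixed hp N
  have hmaps : Set.MapsTo g^[N] (closedBall p r) (closedBall p r) := by
    intro y hy
    have h1 := hsa.dist_le_mul _ (hsub hy).1 _ (hsub (mem_closedBall_self hr.le)).1
    rw [hfix] at h1
    rw [mem_closedBall] at hy ⊢
    nlinarith [dist_nonneg (x := y) (y := p)]
  have hpow : ∀ n : ℕ, ∀ y ∈ closedBall p r, ∀ z ∈ closedBall p r,
      dist ((g^[N])^[n] y) ((g^[N])^[n] z) ≤ a ^ n * dist y z := by
    intro n
    induction n with
    | zero => intro y _ z _; simp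
    | succ n ih =>
      intro y hy z hz
      rw [Function.iterate_succ_apply, Function.iterate_succ_apply]
      calc _ ≤ (a : ℝ) ^ n * dist (g^[N] y) (g^[N] z) := ih _ (hmaps hy) _ (hmaps hz)
        _ ≤ (a : ℝ) ^ n * (a * dist y z) := by
          gcongr
          exact hsa.dist_le_mul _ (hsub hy).1 _ (hsub hz).1
        _ = _ := by ring
  refine ⟨r, hr, fun n => (∑ i ∈ Finset.range N, (K i : ℝ)) * (a : ℝ) ^ (n / N),
    fun n => by positivity, ?_, ?_⟩
  · have h1 : Tendsto (fun n : ℕ => (a : ℝ) ^ (n / N)) atTop (𝓝 0) :=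
      (tendsto_pow_atTop_nhds_zero_of_lt_one a.2 ha1').comp
        (Nat.tendsto_div_const_atTop (by omega))
    simpa using h1.const_mul (∑ i ∈ Finset.range N, (K i : ℝ))
  · intro y hy z hz n
    have hmod : n % N ∈ Finset.range N := Finset.mem_range.2 (Nat.mod_lt _ (by omega))
    have hiter : ∀ w, g^[n] w = g^[n % N] ((g^[N])^[n / N] w) := fun w => by
      rw [← Function.iterate_mul, ← Function.iterate_add_apply, Nat.mod_add_div]
    have hmem : ∀ w ∈ closedBall p r, (g^[N])^[n / N] w ∈ t (n % N) := fun w hw =>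
      Set.mem_iInter₂.1 (hsub (hmaps.iterate _ hw)).2 _ hmod
    rw [hiter, hiter]
    calc _ ≤ K (n % N) * dist ((g^[N])^[n / N] y) ((g^[N])^[n / N] z) :=
          (hK _).dist_le_mul _ (hmem y hy) _ (hmem z hz)
      _ ≤ (∑ i ∈ Finset.range N, (K i : ℝ)) * ((a : ℝ) ^ (n / N) * dist y z) := by
          gcongr
          · exact Finset.single_le_sum (f := fun i => (K i : ℝ)) (fun i _ => (K i).2) hmod
          · exact hpow _ y hy z hz
      _ = _ := by ring

/-- Finitely many asymptotically contracting points admit a common radius and common Lipschitz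
constants. -/
theorem exists_uniform {α ι : Type*} [PseudoMetricSpace α] [Fintype ι] {g : ι → α → α} {q : ι → α}
    (h : ∀ i, ContractsAsymptoticallyNear (g i) (q i)) :
    ∃ δ : ℝ, 0 < δ ∧ ∃ b : ℕ → ℝ, (∀ n, 0 ≤ b n) ∧ Tendsto b atTop (𝓝 0) ∧
      ∀ i, ∀ y ∈ closedBall (q i) δ, ∀ z ∈ closedBall (q i) δ, ∀ n,
        dist ((g i)^[n] y) ((g i)^[n] z) ≤ b n * dist y z := by
  choose δ hδ b hb0 hb H using h
  obtain ⟨δ₀, hδ₀, hle⟩ : ∃ δ₀ : ℝ, 0 < δ₀ ∧ ∀ i, δ₀ ≤ δ i := by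
    cases isEmpty_or_nonempty ι
    · exact ⟨1, one_pos, isEmptyElim⟩
    · obtain ⟨i, hi⟩ := Finite.exists_min δ
      exact ⟨δ i, hδ i, hi⟩
  refine ⟨δ₀, hδ₀, fun n => ∑ i, b i n, fun n => Finset.sum_nonneg fun i _ => hb0 i n, ?_, ?_⟩
  · simpa using tendsto_finsetSum Finset.univ fun i _ => hb i
  · intro i y hy z hz n
    refine (H i y (closedBall_subset_closedBall (hle i) hy) z
      (closedBall_subset_closedBall (hle i) hz) n).trans ?_
    gcongr
    exact Finset.single_le_sum (f := fun i => b i n) (fun i _ => hb0 i n) (Finset.mem_univ i)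

end ContractsAsymptoticallyNear

section Input

variable {M : ℕ} {v : ℤ → Fin M} {m : ℕ}

theorem exists_switch {a b : ℤ} (hab : a ≤ b) (h : v a ≠ v b) :
    ∃ k, a ≤ k ∧ k < b ∧ v k ≠ v (k + 1) := by
  by_contra! hcon
  refine h ?_
  have key : ∀ n : ℕ, a + n ≤ b → v a = v (a + n) := by
    intro n
    induction n with
    | zero => simp
    | succ n ih =>
      intro hn
      push_cast at hn ⊢
      rw [ih (by omega), ← add_assoc, hcon (a + n) (by omega) (by omega)]
  have := key (b - a).toNat (by omega)
  rwa [show a + ((b - a).toNat : ℤ) = b by omega] at this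

theorem MinRepetitions.eq_of_switch {p : ℕ} (hv : MinRepetitions v p) {k s : ℤ}
    (hk : v k ≠ v (k + 1)) (h1 : k < s) (h2 : s ≤ k + p) : v s = v (k + 1) := by
  have := hv k hk (s - k).toNat (by omega) (by omega)
  rwa [show k + ((s - k).toNat : ℤ) = s by omega] at this

theorem MinRepetitions.eq_before_switch (hv : MinRepetitions v (2 * m)) (hm : 1 ≤ m) {k : ℤ}
    (hk : v k ≠ v (k + 1)) {j : ℕ} (hj : j ≤ m) : v (k - j) = v k := by
  by_contra hne
  obtain ⟨s, hs1, hs2, hs⟩ := exists_switch (by omega) hne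
  exact hk ((hv.eq_of_switch hs (by omega) (by omega)).trans
    (hv.eq_of_switch hs (by omega) (by omega)).symm)

/-- The input has been constant over the `m` steps preceding time `t`. -/
def IsSettled (v : ℤ → Fin M) (m : ℕ) (t : ℤ) : Prop :=
  ∀ j : ℕ, 1 ≤ j → j ≤ m → v (t - j) = v (t - 1)

theorem IsSettled.of_switch (hv : MinRepetitions v (2 * m)) (hm : 1 ≤ m) {t : ℤ}
    (ht : v (t - 1) ≠ v t) : IsSettled v m t := by
  intro j h1 h2
  have := hv.eq_before_switch hm (k := t - 1) (by simpa using ht) (j := j - 1) (by omega)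
  rwa [show t - 1 - ((j - 1 : ℕ) : ℤ) = t - j by omega] at this

theorem IsSettled.of_forall_eq {t : ℤ} (hm : 1 ≤ m) (h : ∀ j : ℕ, j ≤ m → v (t - j) = v t) :
    IsSettled v m t := fun j _ h2 => (h j h2).trans (by simpa using (h 1 hm).symm)

theorem IsSettled.exists_prev (hv : MinRepetitions v (2 * m)) (hm : 1 ≤ m) {t : ℤ}
    (ht : IsSettled v m t) :
    ∃ l : ℕ, m ≤ l ∧ l ≤ 2 * m ∧ IsSettled v m (t - l) ∧
      ∀ j : ℕ, 1 ≤ j → j ≤ l → v (t - j) = v (t - 1) := by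
  by_cases h : ∃ l : ℕ, m ≤ l ∧ l < 2 * m ∧ v (t - l - 1) ≠ v (t - l)
  · obtain ⟨l, h1, h2, h3⟩ := h
    have h3' : v (t - l - 1) ≠ v (t - l - 1 + 1) := by simpa using h3
    refine ⟨l, h1, h2.le, IsSettled.of_switch hv hm h3, fun j hj1 hj2 => ?_⟩
    exact (hv.eq_of_switch h3' (by omega) (by omega)).trans
      (hv.eq_of_switch h3' (by omega) (by omega)).symm
  · push Not at h
    have key : ∀ j : ℕ, j ≤ m → v (t - m - j) = v (t - m) := by
      intro j hj
      by_contra hne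
      obtain ⟨s, hs1, hs2, hs⟩ := exists_switch (by omega) hne
      have := h (t - s - 1).toNat (by omega) (by omega)
      rw [show t - ((t - s - 1).toNat : ℤ) = s + 1 by omega] at this
      exact hs (by simpa using this)
    exact ⟨m, le_rfl, by omega, IsSettled.of_forall_eq hm key, ht⟩

theorem MinRepetitions.exists_isSettled (hv : MinRepetitions v (2 * m)) (hm : 1 ≤ m) (k : ℤ) :
    ∃ r : ℕ, IsSettled v m (k - r) ∧ ∀ j : ℕ, j ≤ r → v (k - j) = v k := by
  by_cases h : ∃ r : ℕ, r < m ∧ v (k - r - 1) ≠ v (k - r)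
  · obtain ⟨r, hr, hsw⟩ := h
    have hsw' : v (k - r - 1) ≠ v (k - r - 1 + 1) := by simpa using hsw
    refine ⟨r, IsSettled.of_switch hv hm hsw, fun j hj => ?_⟩
    exact (hv.eq_of_switch hsw' (by omega) (by omega)).trans
      (hv.eq_of_switch hsw' (by omega) (by omega)).symm
  · push Not at h
    refine ⟨0, IsSettled.of_forall_eq hm fun j hj => ?_, fun j hj => by simp [Nat.le_zero.1 hj]⟩
    simp only [Nat.cast_zero, sub_zero]
    by_contra hne
    obtain ⟨s, hs1, hs2, hs⟩ := exists_switch (by omega) hne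
    have := h (k - s - 1).toNat (by omega)
    rw [show k - ((k - s - 1).toNat : ℤ) = s + 1 by omega] at this
    exact hs (by simpa using this)

end Input

section Pullback

variable {d M : ℕ} {f : Fin M → EuclideanSpace ℝ (Fin d) → EuclideanSpace ℝ (Fin d)}
  {v : ℤ → Fin M}

theorem pullComp_add (k : ℤ) (n l : ℕ) :
    pullComp f v k (n + l) = pullComp f v k n ∘ pullComp f v (k - n) l := by
  induction l with
  | zero => rfl
  | succ l ih =>
    rw [← add_assoc, pullComp, pullComp, ih, Function.comp_assoc,
      show k - (((n + l : ℕ) : ℤ) + 1) = k - n - (l + 1) by push_cast; ring]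

theorem pullComp_eq_iterate {k : ℤ} {n : ℕ} {i : Fin M}
    (h : ∀ j : ℕ, 1 ≤ j → j ≤ n → v (k - j) = i) : pullComp f v k n = (f i)^[n] := by
  induction n with
  | zero => rfl
  | succ n ih =>
    rw [pullComp, ih fun j h1 h2 => h j h1 (by omega), Function.iterate_succ]
    have := h (n + 1) (by omega) le_rfl
    push_cast at this
    rw [this]

theorem pullComp_succ (k : ℤ) (n : ℕ) (y : EuclideanSpace ℝ (Fin d)) :
    pullComp f v (k + 1) (n + 1) y = f (v k) (pullComp f v k n y) := by
  rw [add_comm n 1, pullComp_add]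
  simp [pullComp]

theorem mapsTo_pullComp {X : Set (EuclideanSpace ℝ (Fin d))} (hf : ∀ i, Set.MapsTo (f i) X X)
    (k : ℤ) (n : ℕ) : Set.MapsTo (pullComp f v k n) X X := by
  induction n with
  | zero => exact Set.mapsTo_id X
  | succ n ih => exact ih.comp (hf _)

end Pullback

/-- Every attractor has a `δ`-neighbourhood which is attracted, under each input symbol, to the
attractor prescribed by `P`: its iterates are uniformly `C`-Lipschitz, and from the `m`-th one on
they halve distances and land in the `δ`-neighbourhood of the new attractor. -/
structure BlockContraction {d M : ℕ}
    (f : Fin M → EuclideanSpace ℝ (Fin d) → EuclideanSpace ℝ (Fin d)) (L : Fin M → ℕ)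
    (xfix : Fin M → ℕ → EuclideanSpace ℝ (Fin d)) (P : Fin M → ℕ → Fin M → ℕ)
    (δ C : ℝ) (m : ℕ) : Prop where
  radius_pos : 0 < δ
  one_le_lip : 1 ≤ C
  one_le_rep : 1 ≤ m
  lipschitz : ∀ i k, ∀ j < L i, ∀ y ∈ closedBall (xfix i j) δ, ∀ z ∈ closedBall (xfix i j) δ,
    ∀ n, dist ((f k)^[n] y) ((f k)^[n] z) ≤ C * dist y z
  contract : ∀ i k, ∀ j < L i, ∀ y ∈ closedBall (xfix i j) δ, ∀ z ∈ closedBall (xfix i j) δ,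
    ∀ n, m ≤ n → dist ((f k)^[n] y) ((f k)^[n] z) ≤ dist y z / 2
  mapsTo : ∀ i k, ∀ j < L i, ∀ y ∈ closedBall (xfix i j) δ, ∀ n, m ≤ n →
    (f k)^[n] y ∈ closedBall (xfix k (P i j k)) δ
  tendsto : ∀ i k, ∀ j < L i, ∀ y ∈ closedBall (xfix i j) δ,
    Tendsto (fun n : ℕ => (f k)^[n] y) atTop (𝓝 (xfix k (P i j k)))

theorem exists_blockContraction {d M : ℕ}
    {f : Fin M → EuclideanSpace ℝ (Fin d) → EuclideanSpace ℝ (Fin d)}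
    (hreg : ∀ i, ContDiff ℝ 1 (f i)) {L : Fin M → ℕ}
    {xfix : Fin M → ℕ → EuclideanSpace ℝ (Fin d)}
    (hfixed : ∀ i, ∀ j < L i, f i (xfix i j) = xfix i j)
    (hhyp : ∀ i, ∀ j < L i, ∃ N : ℕ, 1 ≤ N ∧ ‖(fderiv ℝ (f i) (xfix i j)) ^ N‖ < 1)
    {P : Fin M → ℕ → Fin M → ℕ} (hPlt : ∀ i k, ∀ j < L i, P i j k < L k)
    (hP : ∀ i k, ∀ j < L i,
      Tendsto (fun n : ℕ => (f k)^[n] (xfix i j)) atTop (𝓝 (xfix k (P i j k)))) :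
    ∃ δ C : ℝ, ∃ m : ℕ, BlockContraction f L xfix P δ C m := by
  have hcontr : ∀ s : (Σ i : Fin M, Fin (L i)) × Fin M,
      ContractsAsymptoticallyNear (f s.2) (xfix s.1.1 s.1.2) := by
    rintro ⟨⟨i, j⟩, k⟩
    obtain ⟨N, hN, hlt⟩ := hhyp k _ (hPlt i k j j.2)
    exact (ContractsAsymptoticallyNear.of_norm_fderiv_pow_lt_one (hreg k)
      (hfixed k _ (hPlt i k j j.2)) hN hlt).of_tendsto (hreg k) (hP i k j j.2)
  obtain ⟨δ, hδ, b, hb0, hb, H⟩ := ContractsAsymptoticallyNear.exists_uniform hcontr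
  have H' : ∀ i k, ∀ j < L i, ∀ y ∈ closedBall (xfix i j) δ, ∀ z ∈ closedBall (xfix i j) δ,
      ∀ n, dist ((f k)^[n] y) ((f k)^[n] z) ≤ b n * dist y z :=
    fun i k j hj => H (⟨i, j, hj⟩, k)
  obtain ⟨C, hC⟩ := hb.bddAbove_range
  have hnear : ∀ᶠ n in atTop, ∀ s : (Σ i : Fin M, Fin (L i)) × Fin M,
      dist ((f s.2)^[n] (xfix s.1.1 s.1.2)) (xfix s.2 (P s.1.1 s.1.2 s.2)) < δ / 2 :=
    eventually_all.2 fun s =>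
      (tendsto_nhds.1 (hP s.1.1 s.2 s.1.2 s.1.2.2) (δ / 2) (half_pos hδ)).mono fun _ h => h
  obtain ⟨m, hm⟩ := eventually_atTop.1
    ((hnear.and (hb.eventually_lt_const one_half_pos)).and (eventually_ge_atTop 1))
  have hcontract : ∀ i k, ∀ j < L i, ∀ y ∈ closedBall (xfix i j) δ,
      ∀ z ∈ closedBall (xfix i j) δ,
      ∀ n, m ≤ n → dist ((f k)^[n] y) ((f k)^[n] z) ≤ dist y z / 2 := by
    intro i k j hj y hy z hz n hn
    have h1 := H' i k j hj y hy z hz n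
    have h2 := (hm n hn).1.2
    nlinarith [dist_nonneg (x := y) (y := z)]
  refine ⟨δ, max C 1, m, hδ, le_max_right _ _, (hm m le_rfl).2, ?_, hcontract, ?_, ?_⟩
  · intro i k j hj y hy z hz n
    refine (H' i k j hj y hy z hz n).trans ?_
    gcongr
    exact (hC ⟨n, rfl⟩).trans (le_max_left _ _)
  · intro i k j hj y hy n hn
    have h1 := hcontract i k j hj y hy _ (mem_closedBall_self hδ.le) n hn
    have h2 := (hm n hn).1.1 (⟨i, j, hj⟩, k)
    rw [mem_closedBall] at hy ⊢
    have h3 := dist_triangle ((f k)^[n] y) ((f k)^[n] (xfix i j)) (xfix k (P i j k))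
    simp only at h2
    linarith
  · intro i k j hj y hy
    refine (tendsto_iff_of_dist ?_).1 (hP i k j hj)
    refine squeeze_zero (fun _ => dist_nonneg)
      (fun n => H' i k j hj _ (mem_closedBall_self hδ.le) y hy n) ?_
    simpa using hb.mul_const (dist (xfix i j) y)

/-- `A` is an entire attractor sequence for the input `v`. -/
structure IsAttractorSequence {M : ℕ} (L : Fin M → ℕ) (P : Fin M → ℕ → Fin M → ℕ)
    (v : ℤ → Fin M) (A : ℤ → ℕ) : Prop where
  lt : ∀ k, A k < L (v k)
  step : ∀ k, A (k + 1) = P (v k) (A k) (v (k + 1))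

theorem IsAttractorSequence.eq_of_const {M : ℕ} {L : Fin M → ℕ} {P : Fin M → ℕ → Fin M → ℕ}
    {v : ℤ → Fin M} {A : ℤ → ℕ} (hA : IsAttractorSequence L P v A)
    (hPid : ∀ i, ∀ j < L i, P i j i = j) {t : ℤ} {n : ℕ}
    (h : ∀ j : ℕ, j ≤ n → v (t - j) = v t) : A (t - n) = A t := by
  induction n with
  | zero => simp
  | succ n ih =>
    rw [← ih fun j hj => h j (by omega)]
    have h1 := hA.step (t - (n + 1 : ℕ))
    have h2 : t - ((n + 1 : ℕ) : ℤ) + 1 = t - n := by push_cast; ring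
    rw [h2, h n (by omega), ← h (n + 1) le_rfl, hPid _ _ (hA.lt _)] at h1
    exact h1.symm

namespace BlockContraction

variable {d M : ℕ} {f : Fin M → EuclideanSpace ℝ (Fin d) → EuclideanSpace ℝ (Fin d)}
  {L : Fin M → ℕ} {xfix : Fin M → ℕ → EuclideanSpace ℝ (Fin d)} {P : Fin M → ℕ → Fin M → ℕ}
  {δ C : ℝ} {m : ℕ} {v : ℤ → Fin M} {A : ℤ → ℕ}

theorem pullComp_mem_of_const (hB : BlockContraction f L xfix P δ C m)
    (hfixed : ∀ i, ∀ j < L i, f i (xfix i j) = xfix i j)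
    (hPid : ∀ i, ∀ j < L i, P i j i = j) (hA : IsAttractorSequence L P v A)
    {t : ℤ} {n : ℕ} (hn : 1 ≤ n) (hconst : ∀ j : ℕ, 1 ≤ j → j ≤ n → v (t - j) = v (t - 1))
    {y : EuclideanSpace ℝ (Fin d)}
    (hy : y ∈ closedBall (xfix (v (t - n)) (A (t - n))) (δ / C)) :
    pullComp f v t n y ∈ closedBall (xfix (v (t - 1)) (A (t - 1))) δ := by
  have hC : 0 < C := one_pos.trans_le hB.one_le_lip
  have hAc : A (t - n) = A (t - 1) := by
    have := hA.eq_of_const hPid (t := t - 1) (n := n - 1) fun j hj => by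
      have := hconst (j + 1) (by omega) (by omega)
      rwa [show t - ((j + 1 : ℕ) : ℤ) = t - 1 - j by push_cast; ring] at this
    rwa [show t - 1 - ((n - 1 : ℕ) : ℤ) = t - n by omega] at this
  rw [hconst n hn le_rfl, hAc] at hy
  have hy' := closedBall_subset_closedBall
    (div_le_self hB.radius_pos.le hB.one_le_lip) hy
  have h := hB.lipschitz (v (t - 1)) (v (t - 1)) _ (hA.lt (t - 1)) y hy' _
    (mem_closedBall_self hB.radius_pos.le) n
  rw [Function.iterate_fixed (hfixed _ _ (hA.lt _))] at h
  rw [pullComp_eq_iterate hconst, mem_closedBall]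
  refine h.trans ?_
  rw [mem_closedBall, le_div_iff₀ hC] at hy
  linarith

theorem pullComp_mem_of_le (hB : BlockContraction f L xfix P δ C m)
    (hPid : ∀ i, ∀ j < L i, P i j i = j) (hA : IsAttractorSequence L P v A)
    {t : ℤ} {n : ℕ} (hn : m ≤ n) (hconst : ∀ j : ℕ, 1 ≤ j → j ≤ n → v (t - j) = v (t - 1))
    {y : EuclideanSpace ℝ (Fin d)}
    (hy : y ∈ closedBall (xfix (v (t - n - 1)) (A (t - n - 1))) δ) :
    pullComp f v t n y ∈ closedBall (xfix (v (t - 1)) (A (t - 1))) δ := by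
  have hm := hB.one_le_rep
  have hAc : A (t - n) = A (t - 1) := by
    have := hA.eq_of_const hPid (t := t - 1) (n := n - 1) fun j hj => by
      have := hconst (j + 1) (by omega) (by omega)
      rwa [show t - ((j + 1 : ℕ) : ℤ) = t - 1 - j by push_cast; ring] at this
    rwa [show t - 1 - ((n - 1 : ℕ) : ℤ) = t - n by omega] at this
  have hstep := hA.step (t - n - 1)
  rw [sub_add_cancel, hAc, hconst n (by omega) le_rfl] at hstep
  rw [pullComp_eq_iterate hconst, hstep]
  exact hB.mapsTo _ _ _ (hA.lt _) y hy n hn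

theorem pullComp_mem (hB : BlockContraction f L xfix P δ C m)
    (hfixed : ∀ i, ∀ j < L i, f i (xfix i j) = xfix i j)
    (hPid : ∀ i, ∀ j < L i, P i j i = j) (hA : IsAttractorSequence L P v A)
    (hv : MinRepetitions v (2 * m)) {n : ℕ} (hn : 1 ≤ n) {t : ℤ} (ht : IsSettled v m t)
    {y : EuclideanSpace ℝ (Fin d)}
    (hy : y ∈ closedBall (xfix (v (t - n)) (A (t - n))) (δ / C)) :
    pullComp f v t n y ∈ closedBall (xfix (v (t - 1)) (A (t - 1))) δ := by
  induction n using Nat.strong_induction_on generalizing t with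
  | _ n ih =>
    obtain ⟨l, hl1, -, hset, hconst⟩ := ht.exists_prev hv hB.one_le_rep
    have hm := hB.one_le_rep
    rcases le_or_gt n l with hnl | hnl
    · exact hB.pullComp_mem_of_const hfixed hPid hA hn
        (fun j h1 h2 => hconst j h1 (h2.trans hnl)) hy
    · obtain ⟨r, rfl⟩ := Nat.exists_eq_add_of_lt hnl
      rw [add_assoc, pullComp_add]
      refine hB.pullComp_mem_of_le hPid hA hl1 hconst (ih (r + 1) (by omega) (by omega) hset ?_)
      rwa [show t - (l : ℤ) - ((r + 1 : ℕ) : ℤ) = t - ((l + r + 1 : ℕ) : ℤ) by push_cast; ring]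

theorem dist_pullComp_le (hB : BlockContraction f L xfix P δ C m)
    (hfixed : ∀ i, ∀ j < L i, f i (xfix i j) = xfix i j)
    (hPid : ∀ i, ∀ j < L i, P i j i = j) (hA : IsAttractorSequence L P v A)
    (hv : MinRepetitions v (2 * m)) (q : ℕ) {t : ℤ} (ht : IsSettled v m t)
    {n n' : ℕ} (hn : 2 * m * q < n) (hn' : 2 * m * q < n') {y z : EuclideanSpace ℝ (Fin d)}
    (hy : y ∈ closedBall (xfix (v (t - n)) (A (t - n))) (δ / C))
    (hz : z ∈ closedBall (xfix (v (t - n')) (A (t - n'))) (δ / C)) :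
    dist (pullComp f v t n y) (pullComp f v t n' z) ≤ 2 * δ * (1 / 2) ^ q := by
  induction q generalizing t n n' with
  | zero =>
    have h1 := hB.pullComp_mem hfixed hPid hA hv (by omega) ht hy
    have h2 := hB.pullComp_mem hfixed hPid hA hv (by omega) ht hz
    have := dist_triangle_right (pullComp f v t n y) (pullComp f v t n' z)
      (xfix (v (t - 1)) (A (t - 1)))
    rw [mem_closedBall] at h1 h2
    linarith
  | succ q ih =>
    obtain ⟨l, hl1, hl2, hset, hconst⟩ := ht.exists_prev hv hB.one_le_rep
    rw [mul_add, mul_one] at hn hn'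
    obtain ⟨r, rfl⟩ := Nat.exists_eq_add_of_le (show l ≤ n by omega)
    obtain ⟨r', rfl⟩ := Nat.exists_eq_add_of_le (show l ≤ n' by omega)
    have hsub : ∀ s : ℕ, t - ((l + s : ℕ) : ℤ) = t - l - s := fun s => by push_cast; ring
    rw [hsub] at hy hz
    have h1 := ih hset (by omega) (by omega) hy hz
    rw [pullComp_add, pullComp_add, pullComp_eq_iterate hconst]
    have h2 := hB.contract _ (v (t - 1)) _ (hA.lt _) _
      (hB.pullComp_mem hfixed hPid hA hv (by omega) hset hy) _
      (hB.pullComp_mem hfixed hPid hA hv (by omega) hset hz) l hl1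
    simp only [Function.comp_apply]
    rw [pow_succ]
    linarith

theorem eventually_dist_pullComp_le (hB : BlockContraction f L xfix P δ C m)
    (hfixed : ∀ i, ∀ j < L i, f i (xfix i j) = xfix i j)
    (hPid : ∀ i, ∀ j < L i, P i j i = j) (hA : IsAttractorSequence L P v A)
    (hv : MinRepetitions v (2 * m)) (k : ℤ) {η : ℝ} (hη : 0 < η) :
    ∃ N : ℕ, ∀ n ≥ N, ∀ n' ≥ N,
      ∀ y ∈ closedBall (xfix (v (k - n)) (A (k - n))) (δ / C),
      ∀ z ∈ closedBall (xfix (v (k - n')) (A (k - n'))) (δ / C),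
        dist (pullComp f v k n y) (pullComp f v k n' z) ≤ η := by
  have hC : 0 < C := one_pos.trans_le hB.one_le_lip
  have hδ := hB.radius_pos
  obtain ⟨r, hset, hconst⟩ := hv.exists_isSettled hB.one_le_rep k
  obtain ⟨q, hq⟩ := exists_pow_lt_of_lt_one (show 0 < η / (C * (2 * δ)) by positivity)
    (one_half_lt_one (α := ℝ))
  rw [lt_div_iff₀ (by positivity)] at hq
  refine ⟨r + (2 * m * q + 1), fun n hn n' hn' y hy z hz => ?_⟩
  obtain ⟨s, rfl⟩ := Nat.exists_eq_add_of_le (show r ≤ n by omega)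
  obtain ⟨s', rfl⟩ := Nat.exists_eq_add_of_le (show r ≤ n' by omega)
  have hsub : ∀ s : ℕ, k - ((r + s : ℕ) : ℤ) = k - r - s := fun s => by push_cast; ring
  rw [hsub] at hy hz
  have h1 := hB.dist_pullComp_le hfixed hPid hA hv q hset (n := s) (n' := s')
    (by omega) (by omega) hy hz
  rw [pullComp_add, pullComp_add, pullComp_eq_iterate fun j _ h2 => hconst j h2]
  refine (hB.lipschitz _ (v k) _ (hA.lt _) _
      (hB.pullComp_mem hfixed hPid hA hv (by omega) hset hy) _
      (hB.pullComp_mem hfixed hPid hA hv (by omega) hset hz) r).trans ?_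
  refine (mul_le_mul_of_nonneg_left h1 hC.le).trans ?_
  linarith

theorem exists_solution (hB : BlockContraction f L xfix P δ C m)
    {X : Set (EuclideanSpace ℝ (Fin d))} (hX : IsClosed X) (hcont : ∀ i, Continuous (f i))
    (hfmap : ∀ i, Set.MapsTo (f i) X X) (hfixX : ∀ i, ∀ j < L i, xfix i j ∈ X)
    (hfixed : ∀ i, ∀ j < L i, f i (xfix i j) = xfix i j)
    (hPid : ∀ i, ∀ j < L i, P i j i = j) (hA : IsAttractorSequence L P v A)
    (hv : MinRepetitions v (2 * m)) :
    ∃ x : ℤ → EuclideanSpace ℝ (Fin d),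
      (∀ k, x k ∈ X) ∧ (∀ k, x (k + 1) = f (v k) (x k)) ∧
      (∀ k, x k ∈ basinOf X (f (v (k + 1))) (xfix (v (k + 1)) (A (k + 1)))) ∧
      ∀ k, Tendsto (fun n : ℕ => sSup ((fun y => ‖pullComp f v k n y - x k‖) ''
        closedBall (xfix (v (k - n)) (A (k - n))) (δ / C))) atTop (𝓝 0) := by
  have hε : 0 < δ / C := div_pos hB.radius_pos (one_pos.trans_le hB.one_le_lip)
  set p : ℤ → ℕ → EuclideanSpace ℝ (Fin d) :=
    fun k n => pullComp f v k n (xfix (v (k - n)) (A (k - n))) with hp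
  have hlim : ∀ k, ∃ x, Tendsto (p k) atTop (𝓝 x) := fun k => by
    refine cauchySeq_tendsto_of_complete (Metric.cauchySeq_iff'.2 fun η hη => ?_)
    obtain ⟨N, hN⟩ := hB.eventually_dist_pullComp_le hfixed hPid hA hv k (half_pos hη)
    exact ⟨N, fun n hn => (hN n hn N le_rfl _ (mem_closedBall_self hε.le) _
      (mem_closedBall_self hε.le)).trans_lt (half_lt_self hη)⟩
  choose x hx using hlim
  have hxX : ∀ k, x k ∈ X := fun k =>
    hX.mem_of_tendsto (hx k) (.of_forall fun n => mapsTo_pullComp hfmap k n (hfixX _ _ (hA.lt _)))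
  have hsol : ∀ k, x (k + 1) = f (v k) (x k) := fun k => by
    refine tendsto_nhds_unique ((tendsto_add_atTop_iff_nat 1).2 (hx (k + 1))) ?_
    refine (((hcont (v k)).tendsto _).comp (hx k)).congr fun n => ?_
    simp only [hp, Function.comp_apply]
    rw [pullComp_succ, show k + 1 - ((n + 1 : ℕ) : ℤ) = k - n by push_cast; ring]
  have hsettled : ∀ t, IsSettled v m t → x t ∈ closedBall (xfix (v (t - 1)) (A (t - 1))) δ :=
    fun t ht => isClosed_closedBall.mem_of_tendsto (hx t) <| (eventually_ge_atTop 1).mono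
      fun n hn => hB.pullComp_mem hfixed hPid hA hv hn ht (mem_closedBall_self hε.le)
  have hiter : ∀ (k : ℤ) (r : ℕ), (∀ j : ℕ, j ≤ r → v (k - j) = v k) →
      x k = (f (v k))^[r] (x (k - r)) := by
    intro k r
    induction r with
    | zero => simp
    | succ r ih =>
      intro h
      have h1 := hsol (k - (r + 1 : ℕ))
      rw [h (r + 1) le_rfl, show k - ((r + 1 : ℕ) : ℤ) + 1 = k - r by push_cast; ring] at h1
      rw [ih fun j hj => h j (by omega), h1, Function.iterate_succ_apply]
  refine ⟨x, hxX, hsol, fun k => ⟨hxX k, ?_⟩, fun k => ?_⟩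
  · by_cases hk : v k = v (k + 1)
    · obtain ⟨r, hset, hconst⟩ := hv.exists_isSettled hB.one_le_rep k
      have hstep := hA.step (k - r - 1)
      rw [sub_add_cancel, hA.eq_of_const hPid hconst, hconst r le_rfl] at hstep
      have hAk := hA.step k
      rw [← hk, hPid _ _ (hA.lt k)] at hAk
      rw [← hk, hAk, hstep, hiter k r hconst]
      have h := hB.tendsto _ (v k) _ (hA.lt _) _ (hsettled _ hset)
      simpa only [Function.iterate_add_apply] using (tendsto_add_atTop_iff_nat r).2 h
    · have hconst : ∀ j : ℕ, j ≤ m → v (k - j) = v k := fun j hj =>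
        hv.eq_before_switch hB.one_le_rep hk hj
      have hset := IsSettled.of_forall_eq hB.one_le_rep hconst
      have hmem := hsettled k hset
      have hAk := hA.eq_of_const hPid (n := 1) fun j hj => hconst j (hj.trans hB.one_le_rep)
      have hvk := hconst 1 hB.one_le_rep
      rw [Nat.cast_one] at hAk hvk
      rw [hvk, hAk] at hmem
      rw [hA.step k]
      exact hB.tendsto _ _ _ (hA.lt k) _ hmem
  · refine Metric.tendsto_atTop.2 fun η hη => ?_
    obtain ⟨N, hN⟩ := hB.eventually_dist_pullComp_le hfixed hPid hA hv k (half_pos hη)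
    refine ⟨N, fun n hn => ?_⟩
    rw [Real.dist_0_eq_abs, abs_of_nonneg (Real.sSup_nonneg ?_)]
    · refine (csSup_le ((nonempty_closedBall.2 hε.le).image _) ?_).trans_lt (half_lt_self hη)
      rintro _ ⟨y, hy, rfl⟩
      beta_reduce
      rw [← dist_eq_norm (pullComp f v k n y) (x k)]
      exact le_of_tendsto (tendsto_const_nhds.dist (hx k)) <| (eventually_ge_atTop N).mono
        fun n' hn' => hN n hn n' hn' y hy _ (mem_closedBall_self hε.le)
    · rintro _ ⟨y, -, rfl⟩
      exact norm_nonneg _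

end BlockContraction

end

/-- Theorem `thm:suff`: under Assumption 1 there exist `m_min ≥ 1` and
`ε > 0` such that for every input `v` with minimum repetitions `≥ m_min`, any `E` pairwise
distinct entire attractor sequences give rise to `E` pairwise distinct entire solutions,
each lying in the prescribed basins and pullback attracting the `ε`-neighbourhood of its
attractor sequence; hence the echo index is at least `E`. -/
theorem echo_index_at_least_number_of_attractor_sequences
    {d M : ℕ} (X : Set (EuclideanSpace ℝ (Fin d)))
    (hXne : X.Nonempty) (hXcomp : IsCompact X)
    (f : Fin M → EuclideanSpace ℝ (Fin d) → EuclideanSpace ℝ (Fin d))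
    (hreg : ∀ i, ContDiff ℝ 1 (f i)) (hfmap : ∀ i, Set.MapsTo (f i) X X)
    (L : Fin M → ℕ) (xfix : Fin M → ℕ → EuclideanSpace ℝ (Fin d))
    (hfixX : ∀ i, ∀ j < L i, xfix i j ∈ X)
    (hfixed : ∀ i, ∀ j < L i, f i (xfix i j) = xfix i j)
    (hdistinct : ∀ i, ∀ j < L i, ∀ j' < L i, xfix i j = xfix i j' → j = j')
    (hhyp : ∀ i, ∀ j < L i, ∃ N : ℕ, 1 ≤ N ∧ ‖(fderiv ℝ (f i) (xfix i j)) ^ N‖ < 1)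
    (P : Fin M → ℕ → Fin M → ℕ)
    (hPid : ∀ i, ∀ j < L i, P i j i = j)
    (hPlt : ∀ i k, ∀ j < L i, P i j k < L k)
    (hPbasin : ∀ i k, ∀ j < L i, xfix i j ∈ basinOf X (f k) (xfix k (P i j k))) :
    ∃ m_min : ℕ, 1 ≤ m_min ∧ ∃ ε : ℝ, 0 < ε ∧
      ∀ v : ℤ → Fin M, MinRepetitions v m_min →
      ∀ E : ℕ, ∀ A : Fin E → ℤ → ℕ,
        (∀ e : Fin E, ∀ k : ℤ, A e k < L (v k)) →
        (∀ e : Fin E, ∀ k : ℤ, A e (k + 1) = P (v k) (A e k) (v (k + 1))) →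
        Function.Injective A →
        ∃ x : Fin E → ℤ → EuclideanSpace ℝ (Fin d),
          Function.Injective x ∧
          ∀ e : Fin E,
            (∀ k : ℤ, x e k ∈ X) ∧
            (∀ k : ℤ, x e (k + 1) = f (v k) (x e k)) ∧
            (∀ k : ℤ, x e k ∈
              basinOf X (f (v (k + 1))) (xfix (v (k + 1)) (A e (k + 1)))) ∧
            (∀ k : ℤ, Filter.Tendsto
              (fun n : ℕ => sSup ((fun y => ‖pullComp f v k n y - x e k‖) ''
                Metric.closedBall (xfix (v (k - n)) (A e (k - n))) ε))
              Filter.atTop (nhds 0)) := by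
  obtain ⟨δ, C, m, hB⟩ := exists_blockContraction hreg hfixed hhyp hPlt
    fun i k j hj => (hPbasin i k j hj).2
  have hm := hB.one_le_rep
  refine ⟨2 * m, by omega, δ / C,
    div_pos hB.radius_pos (one_pos.trans_le hB.one_le_lip), fun v hv E A hlt hstep hinj => ?_⟩
  choose x hxX hsol hbasin hpull using fun e : Fin E =>
    hB.exists_solution hXcomp.isClosed (fun i => (hreg i).continuous) hfmap hfixX hfixed hPid
      (A := A e) ⟨hlt e, hstep e⟩ hv
  refine ⟨x, fun e e' h => hinj (funext fun k => ?_), fun e =>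
    ⟨hxX e, hsol e, hbasin e, hpull e⟩⟩
  have h1 := (hbasin e (k - 1)).2
  have h2 := (hbasin e' (k - 1)).2
  rw [← h] at h2
  rw [sub_add_cancel] at h1 h2
  exact hdistinct _ _ (hlt e k) _ (hlt e' k) (tendsto_nhds_unique h1 h2)
end

section
/- The map f₀ : ℝ² → ℝ² given coordinatewise by f₀(x₁, x₂) = ((3/4)x₁ + (1/4)·tanh((1/2)x₁ + 1/4), (3/4)x₂ + (1/4)·tanh((7/4)x₂ + 1/20)) has at least two distinct fixed points p and q in [−1,1]², which may be chosen with p₂ ∈ (−0.95, −0.9), q₂ ∈ (0.9, 0.95) and p₁ = q₁; at each of these two fixed points the derivative of f₀ has operator norm (with respect to the sup norm on ℝ²) strictly less than 1, so both fixed points are asymptotically stable. -/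
/-- The leaky ESN update map `f₀` for input `u₀ = (1/4, 1/20)`, with leak rate `1/4` and
reservoir matrix `diag(1/2, 7/4)`; the product norm on `ℝ × ℝ` is the sup norm. -/
noncomputable def fZero : ℝ × ℝ → ℝ × ℝ :=
  fun p => (3 / 4 * p.1 + 1 / 4 * Real.tanh (1 / 2 * p.1 + 1 / 4),
            3 / 4 * p.2 + 1 / 4 * Real.tanh (7 / 4 * p.2 + 1 / 20))

open Real Set

lemma Real.hasDerivAt_tanh_one_sub_sq (x : ℝ) : HasDerivAt tanh (1 - tanh x ^ 2) x := by
  have h : HasDerivAt (fun y => sinh y / cosh y) (1 - tanh x ^ 2) x := by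
    have hc := (cosh_pos x).ne'
    refine ((hasDerivAt_sinh x).div (hasDerivAt_cosh x) hc).congr_deriv ?_
    rw [tanh_eq_sinh_div_cosh]
    field_simp
  exact h.congr_of_eventuallyEq (.of_forall tanh_eq_sinh_div_cosh)

lemma Real.continuous_tanh_real : Continuous tanh :=
  continuous_iff_continuousAt.2 fun x => (hasDerivAt_tanh_one_sub_sq x).continuousAt

lemma Real.lt_tanh_of_lt_exp {x y : ℝ} (h : 1 + y < (1 - y) * exp (2 * x)) : y < tanh x := by
  have h1 : exp (2 * x) = exp x * exp x := by rw [← exp_add]; ring_nf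
  have h2 : exp x * exp (-x) = 1 := by rw [← exp_add]; simp
  rw [tanh_eq, lt_div_iff₀ (by positivity)]
  have h3 := mul_lt_mul_of_pos_right h (exp_pos (-x))
  rw [h1] at h3
  have h4 : (1 - y) * (exp x * exp x) * exp (-x) = (1 - y) * exp x := by
    linear_combination (1 - y) * exp x * h2
  linarith

lemma Real.tanh_lt_of_exp_lt {x y : ℝ} (h : (1 - y) * exp (2 * x) < 1 + y) : tanh x < y := by
  have h1 : exp (2 * x) * exp (2 * -x) = 1 := by rw [← exp_add]; ring_nf; simp
  have h3 := mul_lt_mul_of_pos_right h (exp_pos (2 * -x))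
  have := lt_tanh_of_lt_exp (x := -x) (y := -y) (by linear_combination h3 - (1 - y) * h1)
  rw [tanh_neg] at this
  linarith

lemma Real.nine_tenths_lt_tanh {x : ℝ} (hx : 3 / 2 ≤ x) : 0.9 < tanh x := by
  apply lt_tanh_of_lt_exp
  have h : exp 1 ^ 3 ≤ exp (2 * x) := by
    rw [← exp_nat_mul]
    exact exp_le_exp.2 (by push_cast; linarith)
  have h' : (2.7 : ℝ) ^ 3 ≤ exp 1 ^ 3 := by
    gcongr
    linarith [exp_one_gt_d9]
  have h'' : (19 : ℝ) < 2.7 ^ 3 := by norm_num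
  linarith

lemma Real.tanh_lt_nineteen_twentieths {x : ℝ} (hx : x ≤ 7 / 4) : tanh x < 0.95 := by
  apply tanh_lt_of_exp_lt
  have h : exp (2 * x) ^ 2 ≤ exp 1 ^ 7 := by
    rw [← exp_nat_mul, ← exp_nat_mul]
    exact exp_le_exp.2 (by push_cast; linarith)
  have h' : exp 1 ^ 7 ≤ (2.72 : ℝ) ^ 7 := by
    gcongr
    linarith [exp_one_lt_d9]
  have : exp (2 * x) < 39 := by
    refine lt_of_pow_lt_pow_left₀ 2 (by norm_num) ((h.trans h').trans_lt (by norm_num))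
  norm_num
  linarith

lemma exists_tanh_fixedPt {a b l u : ℝ} (hlu : l ≤ u) (hl : l < tanh (a * l + b))
    (hu : tanh (a * u + b) < u) : ∃ x ∈ Ioo l u, tanh (a * x + b) = x := by
  have hc : ContinuousOn (fun x => x - tanh (a * x + b)) (Icc l u) := by
    have := Real.continuous_tanh_real
    fun_prop
  obtain ⟨x, hx, h⟩ := intermediate_value_Ioo hlu hc
    (show (0 : ℝ) ∈ _ from ⟨by linarith, by linarith⟩)
  exact ⟨x, hx, by linarith⟩

lemma norm_fderiv_prodMap_le {g h : ℝ → ℝ} {g' h' C : ℝ} {p : ℝ × ℝ}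
    (hg : HasDerivAt g g' p.1) (hh : HasDerivAt h h' p.2) (hg' : |g'| ≤ C) (hh' : |h'| ≤ C) :
    ‖fderiv ℝ (fun z : ℝ × ℝ => (g z.1, h z.2)) p‖ ≤ C := by
  have h1 := (hg.hasFDerivAt.comp p hasFDerivAt_fst).prodMk
    (hh.hasFDerivAt.comp p hasFDerivAt_snd)
  have hC : 0 ≤ C := (abs_nonneg _).trans hg'
  rw [show fderiv ℝ (fun z : ℝ × ℝ => (g z.1, h z.2)) p = _ from h1.fderiv]
  refine ContinuousLinearMap.opNorm_le_bound _ hC fun v => ?_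
  have hv1 := norm_fst_le v
  have hv2 := norm_snd_le v
  rw [Prod.norm_def]
  refine max_le ?_ ?_
  · simp only [ContinuousLinearMap.prod_apply, ContinuousLinearMap.comp_apply,
      ContinuousLinearMap.coe_fst', ContinuousLinearMap.toSpanSingleton_apply, smul_eq_mul, norm_mul]
    rw [mul_comm]
    exact mul_le_mul hg' hv1 (norm_nonneg _) hC
  · simp only [ContinuousLinearMap.prod_apply, ContinuousLinearMap.comp_apply,
      ContinuousLinearMap.coe_snd', ContinuousLinearMap.toSpanSingleton_apply, smul_eq_mul, norm_mul]
    rw [mul_comm]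
    exact mul_le_mul hh' hv2 (norm_nonneg _) hC

lemma hasDerivAt_leaky_tanh (a b x : ℝ) :
    HasDerivAt (fun x : ℝ => 3 / 4 * x + 1 / 4 * tanh (a * x + b))
      (3 / 4 + 1 / 4 * a * (1 - tanh (a * x + b) ^ 2)) x := by
  have h1 : HasDerivAt (fun x : ℝ => a * x + b) a x := by
    simpa using ((hasDerivAt_id' x).const_mul a).add_const b
  have h2 := (Real.hasDerivAt_tanh_one_sub_sq (a * x + b)).comp x h1
  exact (((hasDerivAt_id' x).const_mul (3 / 4 : ℝ)).add (h2.const_mul (1 / 4 : ℝ))).congr_deriv (by ring)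

lemma norm_fderiv_fZero_lt_one {p : ℝ × ℝ} (hp : 0.81 < tanh (7 / 4 * p.2 + 1 / 20) ^ 2) :
    ‖fderiv ℝ fZero p‖ < 1 := by
  have h1 := tanh_sq_lt_one (1 / 2 * p.1 + 1 / 4)
  have h2 := tanh_sq_lt_one (7 / 4 * p.2 + 1 / 20)
  have h1' := sq_nonneg (tanh (1 / 2 * p.1 + 1 / 4))
  refine (norm_fderiv_prodMap_le (C := 7 / 8) (hasDerivAt_leaky_tanh _ _ _)
    (hasDerivAt_leaky_tanh _ _ _) ?_ ?_).trans_lt (by norm_num)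
  · rw [abs_le]
    constructor <;> linarith
  · norm_num at hp
    rw [abs_le]
    constructor <;> linarith

lemma fZero_eq_self {x y : ℝ} (hx : tanh (1 / 2 * x + 1 / 4) = x)
    (hy : tanh (7 / 4 * y + 1 / 20) = y) : fZero (x, y) = (x, y) := by
  simp only [fZero, hx, hy]
  ext <;> ring

/-- `f₀` has at least two distinct fixed points `p, q ∈ [−1,1]²`, with
`p₂ ∈ (−0.95, −0.9)`, `q₂ ∈ (0.9, 0.95)` and `p₁ = q₁`; at each of them the derivative
has operator norm (w.r.t. the sup norm on `ℝ × ℝ`) strictly less than `1`, so both fixed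
points are asymptotically stable. -/
theorem fZero_two_stable_fixed_points :
    ∃ p q : ℝ × ℝ, p ≠ q ∧
      p ∈ Set.Icc (-1 : ℝ) 1 ×ˢ Set.Icc (-1 : ℝ) 1 ∧
      q ∈ Set.Icc (-1 : ℝ) 1 ×ˢ Set.Icc (-1 : ℝ) 1 ∧
      fZero p = p ∧ fZero q = q ∧
      p.2 ∈ Set.Ioo (-0.95 : ℝ) (-0.9) ∧ q.2 ∈ Set.Ioo (0.9 : ℝ) 0.95 ∧
      p.1 = q.1 ∧
      ‖fderiv ℝ fZero p‖ < 1 ∧ ‖fderiv ℝ fZero q‖ < 1 := by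
  obtain ⟨x, hx, hfx⟩ := exists_tanh_fixedPt (a := 1 / 2) (b := 1 / 4) (l := -1) (u := 1)
    (by norm_num) (neg_one_lt_tanh _) (tanh_lt_one _)
  obtain ⟨y, hy, hfy⟩ := exists_tanh_fixedPt (a := 7 / 4) (b := 1 / 20) (l := -0.95) (u := -0.9)
    (by norm_num)
    (by
      rw [← neg_neg (7 / 4 * _ + _), tanh_neg]
      exact neg_lt_neg (tanh_lt_nineteen_twentieths (by norm_num)))
    (by
      rw [← neg_neg (7 / 4 * _ + _), tanh_neg]
      exact neg_lt_neg (nine_tenths_lt_tanh (by norm_num)))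
  obtain ⟨z, hz, hfz⟩ := exists_tanh_fixedPt (a := 7 / 4) (b := 1 / 20) (l := 0.9) (u := 0.95)
    (by norm_num) (nine_tenths_lt_tanh (by norm_num)) (tanh_lt_nineteen_twentieths (by norm_num))
  have hy' := hy
  have hz' := hz
  norm_num at hy' hz'
  refine ⟨(x, y), (x, z), ?_, ⟨Ioo_subset_Icc_self hx, ?_, ?_⟩, ⟨Ioo_subset_Icc_self hx, ?_, ?_⟩,
    fZero_eq_self hfx hfy, fZero_eq_self hfx hfz, hy, hz, rfl,
    norm_fderiv_fZero_lt_one ?_, norm_fderiv_fZero_lt_one ?_⟩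
  · intro h
    linarith [congrArg Prod.snd h]
  · dsimp only; linarith
  · dsimp only; linarith
  · dsimp only; linarith
  · dsimp only; linarith
  · dsimp only
    rw [hfy]
    norm_num
    nlinarith
  · dsimp only
    rw [hfz]
    norm_num
    nlinarith
end
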